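/- Let ψ : ℂ → ℂ be C^∞-smooth on a neighborhood of 0 with ψ(0) = 0 and invertible real Fréchet derivative at 0. Then ψ is liftable if and only if there exists a function h : ℂ → ℂ, C^∞-smooth on a neighborhood of 0, with h(0) ≠ 0, such that either ψ(z) = z·h(z) for all z in a neighborhood of 0, or ψ(z) = conj(z)·h(z) for all z in a neighborhood of 0. -/

import Mathlib

open Complex Filter Topology

/-- A map `ψ : ℂ → ℂ`, smooth near `0` with `ψ 0 = 0` and invertible real Fréchet
derivative at `0`, is *liftable* if there is a map `Ψ : ℂ × ℂ → ℂ × ℂ`, smooth near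
`(0,0)`, with `Ψ (0,0) = (0,0)`, invertible real Fréchet derivative at `(0,0)`, such
that near `(0,0)` the product of the two components of `Ψ (u,v)` equals `ψ (u·v)`. -/
def Liftable (ψ : ℂ → ℂ) : Prop :=
  ∃ Ψ : ℂ × ℂ → ℂ × ℂ,
    ContDiffAt ℝ (⊤ : ℕ∞) Ψ 0 ∧ Ψ 0 = 0 ∧ IsUnit (fderiv ℝ Ψ 0) ∧
    ∀ᶠ p : ℂ × ℂ in 𝓝 0, (Ψ p).1 * (Ψ p).2 = ψ (p.1 * p.2)


section ParamIntegral
open MeasureTheory intervalIntegral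

/-- Auxiliary facts about the rescaled integrand. -/
lemma lift_scale_mem {r t : ℝ} {z : ℂ} (ht : t ∈ Set.uIcc (0:ℝ) 1) (hz : ‖z‖ < r) :
    ‖t • z‖ < r := by
  rw [Set.uIcc_of_le zero_le_one] at ht
  rw [norm_smul, Real.norm_eq_abs, abs_of_nonneg ht.1]
  nlinarith [norm_nonneg z, ht.2, ht.1]

lemma lift_integrand_cont {E : Type} [NormedAddCommGroup E] [NormedSpace ℝ E]
    {f : ℂ → E} {φ : ℝ → ℝ} (hφ : Continuous φ) {r : ℝ}
    (hf : ContinuousOn f (Metric.ball 0 r)) {z : ℂ} (hz : ‖z‖ < r) :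
    ContinuousOn (fun t : ℝ => φ t • f (t • z)) (Set.uIcc 0 1) := by
  refine hφ.continuousOn.smul (hf.comp (by fun_prop) ?_)
  intro t ht
  simpa using lift_scale_mem ht hz

lemma lift_ae_meas {E : Type} [NormedAddCommGroup E] [NormedSpace ℝ E]
    {g : ℝ → E} (hg : ContinuousOn g (Set.uIcc 0 1)) :
    AEStronglyMeasurable g (volume.restrict (Set.uIoc 0 1)) :=
  (hg.mono Set.uIoc_subset_uIcc).aestronglyMeasurable measurableSet_uIoc

lemma lift_bound {E : Type} [NormedAddCommGroup E] [NormedSpace ℝ E]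
    {f : ℂ → E} {r : ℝ} (hr : 0 < r)
    (hf : ContinuousOn f (Metric.ball 0 r)) :
    ∃ C, ∀ z : ℂ, ‖z‖ < r / 2 → ∀ t ∈ Set.uIcc (0:ℝ) 1, ‖f (t • z)‖ ≤ C := by
  obtain ⟨C, hC⟩ := (isCompact_closedBall (0:ℂ) (r/2)).exists_bound_of_continuousOn
    (hf.mono (Metric.closedBall_subset_ball (by linarith)))
  refine ⟨C, fun z hz t ht => hC _ ?_⟩
  simpa using (lift_scale_mem ht hz).le

lemma lift_param_contDiffAt (n : ℕ) : ∀ {E : Type} [NormedAddCommGroup E] [NormedSpace ℝ E]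
    (f : ℂ → E) (φ : ℝ → ℝ), Continuous φ → ContDiffAt ℝ n f 0 →
    ContDiffAt ℝ n (fun z => ∫ t in (0:ℝ)..1, φ t • f (t • z)) 0 := by
  induction n with
  | zero =>
    intro E _ _ f φ hφ hf
    simp only [Nat.cast_zero] at hf ⊢
    rw [contDiffAt_zero] at hf ⊢
    obtain ⟨u, hu, hfu⟩ := hf
    obtain ⟨r, hr, hru⟩ := Metric.mem_nhds_iff.1 hu
    have hfr := hfu.mono hru
    obtain ⟨C, hC⟩ := lift_bound hr hfr
    refine ⟨Metric.ball 0 (r/2), Metric.ball_mem_nhds _ (by positivity), fun z hz => ?_⟩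
    have hz' : ‖z‖ < r / 2 := by simpa using hz
    refine ContinuousAt.continuousWithinAt ?_
    have hev : ∀ᶠ x in 𝓝 z, ‖x‖ < r / 2 := by
      filter_upwards [Metric.isOpen_ball.mem_nhds hz] with x hx
      simpa using hx
    refine continuousAt_of_dominated_interval (bound := fun t => |φ t| * C) ?_ ?_ ?_ ?_
    · filter_upwards [hev] with x hx
      exact lift_ae_meas (lift_integrand_cont hφ hfr (by linarith))
    · filter_upwards [hev] with x hx
      refine Eventually.of_forall fun t ht => ?_
      rw [norm_smul, Real.norm_eq_abs]
      exact mul_le_mul_of_nonneg_left (hC x hx t (Set.uIoc_subset_uIcc ht)) (abs_nonneg _)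
    · exact Continuous.intervalIntegrable (by fun_prop) _ _
    · refine Eventually.of_forall fun t ht => ?_
      refine ContinuousAt.const_smul ?_ _
      have h1 : ContinuousAt f (t • z) := by
        refine hfr.continuousAt (Metric.isOpen_ball.mem_nhds ?_)
        simpa using lift_scale_mem (Set.uIoc_subset_uIcc ht) (show ‖z‖ < r by linarith)
      exact ContinuousAt.comp (f := fun x : ℂ => t • x) h1 (by fun_prop)
  | succ n ih =>
    intro E _ _ f φ hφ hf
    push_cast at hf ⊢
    have hf' : ContDiffAt ℝ n (fderiv ℝ f) 0 := hf.fderiv_right le_rfl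
    rw [contDiffAt_succ_iff_hasFDerivAt]
    refine ⟨fun z => ∫ t in (0:ℝ)..1, (φ t * t) • fderiv ℝ f (t • z), ?_,
      ih _ (fun t => φ t * t) (by fun_prop) hf'⟩
    have hev : ∀ᶠ x in 𝓝 (0:ℂ), ContDiffAt ℝ (n + 1 : ℕ) f x := by
      refine ContDiffAt.eventually (by exact_mod_cast hf) (by simp)
    obtain ⟨r, hr, hru⟩ := Metric.mem_nhds_iff.1 hev
    replace hru : ∀ x ∈ Metric.ball (0:ℂ) r, ContDiffAt ℝ (n + 1 : ℕ) f x := fun x hx => hru hx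
    have hd : ∀ x ∈ Metric.ball (0:ℂ) r, DifferentiableAt ℝ f x := fun x hx =>
      (hru x hx).differentiableAt (by simp)
    have hfr : ContinuousOn f (Metric.ball 0 r) := fun x hx =>
      (hd x hx).continuousAt.continuousWithinAt
    have hfr' : ContinuousOn (fderiv ℝ f) (Metric.ball 0 r) := fun x hx =>
      ((hru x hx).continuousAt_fderiv (by simp)).continuousWithinAt
    obtain ⟨C, hC⟩ := lift_bound hr hfr'
    refine ⟨Metric.ball 0 (r/2), Metric.ball_mem_nhds _ (by positivity), fun z hz => ?_⟩
    have hz' : ‖z‖ < r / 2 := by simpa using hz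
    refine hasFDerivAt_integral_of_dominated_of_fderiv_le (s := Metric.ball 0 (r/2))
      (F := fun z t => φ t • f (t • z))
      (F' := fun z t => (φ t * t) • fderiv ℝ f (t • z))
      (bound := fun t => |φ t * t| * C)
      (Metric.isOpen_ball.mem_nhds hz) ?_ ?_ ?_ ?_ ?_ ?_
    · filter_upwards [Metric.isOpen_ball.mem_nhds hz] with x hx
      have hx' : ‖x‖ < r / 2 := by simpa using hx
      exact lift_ae_meas (lift_integrand_cont hφ hfr (by linarith))
    · exact (lift_integrand_cont hφ hfr (by linarith)).intervalIntegrable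
    · exact lift_ae_meas (lift_integrand_cont (φ := fun t => φ t * t) (by fun_prop) hfr'
        (by linarith))
    · refine Eventually.of_forall fun t ht x hx => ?_
      have hx' : ‖x‖ < r / 2 := by simpa using hx
      rw [norm_smul, Real.norm_eq_abs]
      exact mul_le_mul_of_nonneg_left (hC x hx' t (Set.uIoc_subset_uIcc ht)) (abs_nonneg _)
    · exact Continuous.intervalIntegrable (by fun_prop) _ _
    · refine Eventually.of_forall fun t ht x hx => ?_
      have hx' : ‖x‖ < r / 2 := by simpa using hx
      have h1 : HasFDerivAt f (fderiv ℝ f (t • x)) (t • x) := by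
        refine (hd _ ?_).hasFDerivAt
        simpa using lift_scale_mem (Set.uIoc_subset_uIcc ht) (show ‖x‖ < r by linarith)
      have h2 : HasFDerivAt (fun x : ℂ => t • x) (t • ContinuousLinearMap.id ℝ ℂ) x :=
        (hasFDerivAt_id x).const_smul t
      have h3 := (h1.comp x h2).const_smul (φ t)
      refine h3.congr_fderiv ?_
      ext v
      simp [mul_smul]

/-- Wirtinger-type operator. -/
noncomputable def Wd {E : Type} [NormedAddCommGroup E] [NormedSpace ℝ E] (e₁ e₂ : E)
    (f : E → ℂ) (p : E) : ℂ :=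
  (fderiv ℝ f p e₁ + I * fderiv ℝ f p e₂) / 2

noncomputable abbrev dz : (ℂ → ℂ) → ℂ → ℂ := Wd 1 (-I)
noncomputable abbrev dzb : (ℂ → ℂ) → ℂ → ℂ := Wd 1 I

lemma clm_expand (L : ℂ →L[ℝ] ℂ) (w : ℂ) :
    L w = (L 1 + I * L (-I)) / 2 * w + (L 1 + I * L I) / 2 * (starRingEnd ℂ) w := by
  have h : L w = w.re * L 1 + w.im * L I := by
    conv_lhs => rw [show w = w.re • (1:ℂ) + w.im • I by simp [Complex.re_add_im w]]
    rw [map_add, map_smul, map_smul]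
    simp
  rw [h, map_neg]
  conv_rhs => rw [← Complex.re_add_im w]
  simp only [map_add, map_mul, conj_ofReal, conj_I]
  linear_combination ((w.im : ℂ) * L I) * I_mul_I

lemma fderiv_expand (f : ℂ → ℂ) (p w : ℂ) :
    fderiv ℝ f p w = dz f p * w + dzb f p * (starRingEnd ℂ) w := clm_expand _ _

lemma Wd_contDiffAt {E : Type} [NormedAddCommGroup E] [NormedSpace ℝ E] (e₁ e₂ : E)
    {f : E → ℂ} {p : E} (hf : ContDiffAt ℝ (⊤ : ℕ∞) f p) :
    ContDiffAt ℝ (⊤ : ℕ∞) (Wd e₁ e₂ f) p := by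
  have h := hf.fderiv_right (m := (⊤ : ℕ∞)) (by simp)
  have h1 : ContDiffAt ℝ (⊤ : ℕ∞) (fun q => fderiv ℝ f q e₁) p := h.clm_apply contDiffAt_const
  have h2 : ContDiffAt ℝ (⊤ : ℕ∞) (fun q => fderiv ℝ f q e₂) p := h.clm_apply contDiffAt_const
  exact (h1.add (contDiffAt_const.mul h2)).div_const 2

lemma ev_diff {E F : Type} [NormedAddCommGroup E] [NormedSpace ℝ E] [NormedAddCommGroup F]
    [NormedSpace ℝ F]
    {f : E → F} {p : E} (hf : ContDiffAt ℝ (⊤ : ℕ∞) f p) :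
    ∀ᶠ q in 𝓝 p, ContDiffAt ℝ 1 f q :=
  (hf.of_le (m := 1) (by exact_mod_cast le_top)).eventually (by simp)

lemma hadamard {f : ℂ → ℂ} (hf : ContDiffAt ℝ (⊤ : ℕ∞) f 0) (h0 : f 0 = 0) :
    ∃ f1 f2 : ℂ → ℂ, ContDiffAt ℝ (⊤ : ℕ∞) f1 0 ∧ ContDiffAt ℝ (⊤ : ℕ∞) f2 0 ∧
      ∀ᶠ z in 𝓝 0, f z = z * f1 z + (starRingEnd ℂ) z * f2 z := by
  have key : ∀ g : ℂ → ℂ, ContDiffAt ℝ (⊤ : ℕ∞) g 0 →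
      ContDiffAt ℝ (⊤ : ℕ∞) (fun z => ∫ t in (0:ℝ)..1, g (t • z)) 0 := by
    intro g hg
    rw [contDiffAt_infty] at hg ⊢
    intro n
    simpa using lift_param_contDiffAt n g (fun _ => 1) continuous_const (hg n)
  refine ⟨_, _, key _ (Wd_contDiffAt 1 (-I) hf), key _ (Wd_contDiffAt 1 I hf), ?_⟩
  obtain ⟨r, hr, hru⟩ := Metric.mem_nhds_iff.1 (ev_diff hf)
  filter_upwards [Metric.ball_mem_nhds _ hr] with z hz
  have hz' : ‖z‖ < r := by simpa using hz
  have hmem : ∀ t ∈ Set.uIcc (0:ℝ) 1, ContDiffAt ℝ 1 f (t • z) := fun t ht =>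
    hru (by simpa using lift_scale_mem ht hz')
  have hc : ContinuousOn (fun t : ℝ => fderiv ℝ f (t • z)) (Set.uIcc 0 1) := fun t ht =>
    (ContinuousAt.comp (f := fun t : ℝ => t • z)
      ((hmem t ht).continuousAt_fderiv (by simp)) (by fun_prop)).continuousWithinAt
  have hc1 : ∀ v, ContinuousOn (fun t : ℝ => fderiv ℝ f (t • z) v) (Set.uIcc 0 1) := fun v =>
    hc.clm_apply continuousOn_const
  have hcw : ∀ v, IntervalIntegrable (fun t : ℝ => Wd 1 v f (t • z)) volume 0 1 := fun v =>
    (((hc1 1).add (continuousOn_const.mul (hc1 v))).div_const 2).intervalIntegrable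
  have hFTC : ∫ t in (0:ℝ)..1, fderiv ℝ f (t • z) z = f z - f 0 := by
    have := integral_eq_sub_of_hasDerivAt (a := (0:ℝ)) (b := 1)
      (f := fun t : ℝ => f (t • z)) (f' := fun t => fderiv ℝ f (t • z) z)
      (fun t ht => ?_) (hc1 z).intervalIntegrable
    · simpa using this
    · have h1 := ((hmem t ht).differentiableAt (by simp)).hasFDerivAt
      have h2 : HasDerivAt (fun t : ℝ => t • z) z t := by
        simpa using (hasDerivAt_id t).smul_const z
      exact h1.comp_hasDerivAt t h2
  rw [h0, sub_zero] at hFTC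
  rw [← hFTC, ← intervalIntegral.integral_const_mul, ← intervalIntegral.integral_const_mul,
    ← intervalIntegral.integral_add ((hcw _).const_mul _) ((hcw _).const_mul _)]
  refine intervalIntegral.integral_congr fun t _ => ?_
  simp only [fderiv_expand f (t • z) z]
  ring

end ParamIntegral

section Operators
variable {E : Type} [NormedAddCommGroup E] [NormedSpace ℝ E]

lemma Wd_congr (e₁ e₂ : E) {f g : E → ℂ} {p : E} (h : f =ᶠ[𝓝 p] g) :
    Wd e₁ e₂ f =ᶠ[𝓝 p] Wd e₁ e₂ g := by
  filter_upwards [h.fderiv (𝕜 := ℝ)] with q hq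
  simp [Wd, hq]

lemma Wd_iter_congr (e₁ e₂ : E) (k : ℕ) : ∀ {f g : E → ℂ} {p : E} (_ : f =ᶠ[𝓝 p] g),
    (Wd e₁ e₂)^[k] f =ᶠ[𝓝 p] (Wd e₁ e₂)^[k] g := by
  induction k with
  | zero => intro f g p h; simpa using h
  | succ k ih =>
    intro f g p h
    rw [Function.iterate_succ_apply, Function.iterate_succ_apply]
    exact ih (Wd_congr _ _ h)

lemma Wd_iter_contDiffAt (e₁ e₂ : E) (k : ℕ) {f : E → ℂ} {p : E}
    (h : ContDiffAt ℝ (⊤ : ℕ∞) f p) : ContDiffAt ℝ (⊤ : ℕ∞) ((Wd e₁ e₂)^[k] f) p := by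
  induction k with
  | zero => simpa using h
  | succ k ih =>
    rw [Function.iterate_succ_apply']
    exact Wd_contDiffAt _ _ ih

lemma Wd_mul (e₁ e₂ : E) {f g : E → ℂ} {p : E} (hf : DifferentiableAt ℝ f p)
    (hg : DifferentiableAt ℝ g p) :
    Wd e₁ e₂ (fun q => f q * g q) p = Wd e₁ e₂ f p * g p + f p * Wd e₁ e₂ g p := by
  simp only [Wd, fderiv_fun_mul hf hg]
  simp
  ring

lemma Wd_add (e₁ e₂ : E) {f g : E → ℂ} {p : E} (hf : DifferentiableAt ℝ f p)
    (hg : DifferentiableAt ℝ g p) :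
    Wd e₁ e₂ (fun q => f q + g q) p = Wd e₁ e₂ f p + Wd e₁ e₂ g p := by
  simp only [Wd, fderiv_fun_add hf hg]
  simp
  ring

lemma ev_differentiable {F : Type} [NormedAddCommGroup F] [NormedSpace ℝ F] {f : E → F} {p : E}
    (hf : ContDiffAt ℝ (⊤ : ℕ∞) f p) :
    ∀ᶠ q in 𝓝 p, DifferentiableAt ℝ f q :=
  (ev_diff hf).mono fun _ h => h.differentiableAt (by simp)

lemma Wd_iter_add (e₁ e₂ : E) (k : ℕ) : ∀ {f g : E → ℂ} {p : E}
    (_ : ContDiffAt ℝ (⊤ : ℕ∞) f p) (_ : ContDiffAt ℝ (⊤ : ℕ∞) g p),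
    (Wd e₁ e₂)^[k] (fun q => f q + g q) =ᶠ[𝓝 p]
      fun q => (Wd e₁ e₂)^[k] f q + (Wd e₁ e₂)^[k] g q := by
  induction k with
  | zero => intro f g p _ _; exact EventuallyEq.rfl
  | succ k ih =>
    intro f g p hf hg
    have h1 : Wd e₁ e₂ (fun q => f q + g q) =ᶠ[𝓝 p] fun q => Wd e₁ e₂ f q + Wd e₁ e₂ g q := by
      filter_upwards [ev_differentiable hf, ev_differentiable hg] with q h1 h2
      exact Wd_add _ _ h1 h2
    simp only [Function.iterate_succ_apply]
    exact (Wd_iter_congr _ _ k h1).trans (ih (Wd_contDiffAt _ _ hf) (Wd_contDiffAt _ _ hg))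

end Operators

lemma conj_hasFDerivAt (z : ℂ) : HasFDerivAt (fun w : ℂ => (starRingEnd ℂ) w)
    (conjCLE : ℂ →L[ℝ] ℂ) z := conjCLE.hasFDerivAt

lemma conj_contDiff {n : WithTop ℕ∞} : ContDiff ℝ n (fun w : ℂ => (starRingEnd ℂ) w) :=
  conjCLE.contDiff

lemma dzb_conj (z : ℂ) : dzb (fun w : ℂ => (starRingEnd ℂ) w) z = 1 := by
  simp [Wd, (conj_hasFDerivAt z).fderiv]

lemma dz_conj (z : ℂ) : dz (fun w : ℂ => (starRingEnd ℂ) w) z = 0 := by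
  simp [Wd, (conj_hasFDerivAt z).fderiv]

/-- The vector field annihilating `β`. -/
noncomputable def Dv (β f : ℂ → ℂ) (z : ℂ) : ℂ := dzb f z * dz β z - dzb β z * dz f z

lemma Dv_congr (β : ℂ → ℂ) {f g : ℂ → ℂ} {p : ℂ} (h : f =ᶠ[𝓝 p] g) :
    Dv β f =ᶠ[𝓝 p] Dv β g := by
  filter_upwards [Wd_congr 1 I h, Wd_congr 1 (-I) h] with q h1 h2
  simp [Dv, h1, h2]

lemma Dv_iter_congr (β : ℂ → ℂ) (k : ℕ) : ∀ {f g : ℂ → ℂ} {p : ℂ} (_ : f =ᶠ[𝓝 p] g),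
    (Dv β)^[k] f =ᶠ[𝓝 p] (Dv β)^[k] g := by
  induction k with
  | zero => intro f g p h; simpa using h
  | succ k ih =>
    intro f g p h
    rw [Function.iterate_succ_apply, Function.iterate_succ_apply]
    exact ih (Dv_congr _ h)

lemma Dv_contDiffAt {β f : ℂ → ℂ} {p : ℂ} (hβ : ContDiffAt ℝ (⊤ : ℕ∞) β p)
    (hf : ContDiffAt ℝ (⊤ : ℕ∞) f p) : ContDiffAt ℝ (⊤ : ℕ∞) (Dv β f) p :=
  ((Wd_contDiffAt _ _ hf).mul (Wd_contDiffAt _ _ hβ)).sub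
    ((Wd_contDiffAt _ _ hβ).mul (Wd_contDiffAt _ _ hf))

lemma Dv_mul (β : ℂ → ℂ) {f g : ℂ → ℂ} {p : ℂ} (hf : DifferentiableAt ℝ f p)
    (hg : DifferentiableAt ℝ g p) :
    Dv β (fun q => f q * g q) p = Dv β f p * g p + f p * Dv β g p := by
  simp only [Dv, Wd_mul _ _ hf hg]
  ring

lemma Dv_add (β : ℂ → ℂ) {f g : ℂ → ℂ} {p : ℂ} (hf : DifferentiableAt ℝ f p)
    (hg : DifferentiableAt ℝ g p) :
    Dv β (fun q => f q + g q) p = Dv β f p + Dv β g p := by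
  simp only [Dv, Wd_add _ _ hf hg]
  ring

lemma Dv_self (β : ℂ → ℂ) (p : ℂ) : Dv β β p = 0 := by
  simp only [Dv]; ring

lemma Dv_conj (β : ℂ → ℂ) (p : ℂ) : Dv β (fun w : ℂ => (starRingEnd ℂ) w) p = dz β p := by
  simp only [Dv, dz_conj, dzb_conj]; ring

lemma Dv_conj_pow (β : ℂ → ℂ) (p : ℂ) (k : ℕ) :
    Dv β (fun w : ℂ => (starRingEnd ℂ) w ^ (k + 1)) p
      = (k + 1) * (starRingEnd ℂ) p ^ k * dz β p := by
  induction k with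
  | zero => simp [Dv_conj]
  | succ k ih =>
    have h1 : DifferentiableAt ℝ (fun w : ℂ => (starRingEnd ℂ) w) p :=
      (conj_hasFDerivAt p).differentiableAt
    have := Dv_mul β (f := fun w : ℂ => (starRingEnd ℂ) w ^ (k + 1)) (h1.pow _) h1
    simp only [pow_succ _ (k + 1)]
    rw [this, ih, Dv_conj]
    push_cast
    ring

lemma Dv_id (f : ℂ → ℂ) : Dv (fun z => z) f = dzb f := by
  funext z
  have h : fderiv ℝ (fun z : ℂ => z) z = ContinuousLinearMap.id ℝ ℂ := fderiv_fun_id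
  simp [Dv, Wd, h]

lemma key_formula {β : ℂ → ℂ} (hβ : ContDiffAt ℝ (⊤ : ℕ∞) β 0) (hβ0 : β 0 = 0) (k : ℕ) :
    ∀ {X Y : ℂ → ℂ} (_ : ContDiffAt ℝ (⊤ : ℕ∞) X 0) (_ : ContDiffAt ℝ (⊤ : ℕ∞) Y 0),
    (Dv β)^[k] (fun z => β z * X z + (starRingEnd ℂ) z ^ k * Y z) 0
      = k.factorial * dz β 0 ^ k * Y 0 := by
  induction k with
  | zero => intro X Y _ _; simp [hβ0]
  | succ k ih =>
    intro X Y hX hY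
    rw [Function.iterate_succ_apply]
    have h1 : Dv β (fun z => β z * X z + (starRingEnd ℂ) z ^ (k + 1) * Y z) =ᶠ[𝓝 0]
        fun z => β z * Dv β X z + (starRingEnd ℂ) z ^ k *
          (((k : ℂ) + 1) * dz β z * Y z + (starRingEnd ℂ) z * Dv β Y z) := by
      filter_upwards [ev_differentiable hX, ev_differentiable hY, ev_differentiable hβ]
        with z h1 h2 h3
      have h4 : DifferentiableAt ℝ (fun w : ℂ => (starRingEnd ℂ) w ^ (k + 1)) z :=
        (conj_hasFDerivAt z).differentiableAt.pow _
      rw [Dv_add β (h3.fun_mul h1) (h4.fun_mul h2), Dv_mul β h3 h1, Dv_mul β h4 h2, Dv_self,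
        Dv_conj_pow]
      ring
    rw [(Dv_iter_congr β k h1).eq_of_nhds, ih (Dv_contDiffAt hβ hX)
      (((contDiffAt_const.mul (Wd_contDiffAt _ _ hβ)).mul hY).add
        (conj_contDiff.contDiffAt.mul (Dv_contDiffAt hβ hY)))]
    simp [Nat.factorial_succ]
    ring

/-- `conj z ^ m / z ^ l` is `C^k` when `m ≥ l + k + 1`. -/
lemma conj_pow_div_contDiff (k : ℕ) : ∀ m l : ℕ, l + k + 1 ≤ m →
    ContDiff ℝ k (fun z : ℂ => (starRingEnd ℂ) z ^ m / z ^ l) := by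
  have hnorm : ∀ (m l : ℕ), l ≤ m → ∀ z : ℂ, ‖(starRingEnd ℂ) z ^ m / z ^ l‖ ≤ ‖z‖ ^ (m - l) := by
    intro m l h z
    rw [norm_div, norm_pow, norm_pow, RCLike.norm_conj]
    rcases eq_or_ne z 0 with rfl | hz
    · rcases Nat.eq_zero_or_pos l with rfl | hl
      · simp
      · simp [hl.ne']
    · rw [pow_sub₀ _ (norm_ne_zero_iff.2 hz) h, div_eq_mul_inv]
  induction k with
  | zero =>
    intro m l h
    rw [Nat.cast_zero, contDiff_zero, continuous_iff_continuousAt]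
    intro z
    rcases eq_or_ne z 0 with rfl | hz
    · rw [ContinuousAt]
      have h0 : (starRingEnd ℂ) (0:ℂ) ^ m / 0 ^ l = 0 := by
        rw [map_zero, zero_pow (by omega), zero_div]
      rw [h0]
      refine squeeze_zero_norm (hnorm m l (by omega)) ?_
      have : Continuous (fun z : ℂ => ‖z‖ ^ (m - l)) := by fun_prop
      have h2 := this.tendsto 0
      simpa [zero_pow (show m - l ≠ 0 by omega)] using h2
    · have h1 : Continuous (fun w : ℂ => (starRingEnd ℂ) w) := continuous_conj
      exact (h1.pow m).continuousAt.div (by fun_prop) (pow_ne_zero _ hz)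
  | succ k ih =>
    intro m l h
    push_cast
    rw [contDiff_succ_iff_hasFDerivAt]
    refine ⟨fun z => (-(l : ℂ) * ((starRingEnd ℂ) z ^ m / z ^ (l + 1))) •
        (ContinuousLinearMap.id ℝ ℂ) +
        ((m : ℂ) * ((starRingEnd ℂ) z ^ (m - 1) / z ^ l)) • (conjCLE : ℂ →L[ℝ] ℂ), ?_, ?_⟩
    · exact ((contDiff_const.mul (ih m (l + 1) (by omega))).smul contDiff_const).add
        ((contDiff_const.mul (ih (m - 1) l (by omega))).smul contDiff_const)
    · intro z
      rcases eq_or_ne z 0 with rfl | hz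
      · have e1 : (-(l : ℂ) * ((starRingEnd ℂ) 0 ^ m / 0 ^ (l + 1))) = 0 := by simp
        have e2 : ((m : ℂ) * ((starRingEnd ℂ) 0 ^ (m - 1) / 0 ^ l)) = 0 := by
          simp [zero_pow (show m - 1 ≠ 0 by omega)]
        suffices h00 : HasFDerivAt (fun z : ℂ => (starRingEnd ℂ) z ^ m / z ^ l)
            (0 : ℂ →L[ℝ] ℂ) 0 by
          refine h00.congr_fderiv ?_
          simp only [e1, e2]
          ext v
          simp
        rw [hasFDerivAt_iff_isLittleO_nhds_zero]
        have h0 : (starRingEnd ℂ) (0:ℂ) ^ m / 0 ^ l = 0 := by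
          rw [map_zero, zero_pow (by omega), zero_div]
        simp only [zero_add, h0, sub_zero, _root_.zero_apply]
        have hb : (fun z : ℂ => (starRingEnd ℂ) z ^ m / z ^ l) =O[𝓝 0]
            fun z : ℂ => ‖z‖ ^ (m - l) :=
          Asymptotics.IsBigO.of_bound 1 (Eventually.of_forall fun z => by
            simpa using hnorm m l (by omega) z)
        exact hb.trans_isLittleO (Asymptotics.isLittleO_norm_pow_id (by omega))
      · have h1 : HasFDerivAt (fun w : ℂ => (starRingEnd ℂ) w ^ m) _ z :=
          (conj_hasFDerivAt z).pow m
        have h2 : HasDerivAt (fun w : ℂ => (w ^ l)⁻¹) _ z :=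
          (hasDerivAt_pow l z).inv (pow_ne_zero _ hz)
        have h3 := h1.mul (h2.hasFDerivAt.restrictScalars ℝ)
        refine (h3.congr_fderiv ?_).congr_of_eventuallyEq
          (Eventually.of_forall fun w => div_eq_mul_inv _ _)
        have key : (l:ℂ) * z ^ (l - 1) * z = l * z ^ l := by
          rcases l with _ | l
          · simp
          · simp [pow_succ]; ring
        have key2 : (l:ℂ) * z ^ (l - 1) / (z ^ l) ^ 2 = l / z ^ (l + 1) := by
          rw [div_eq_div_iff (by positivity) (by positivity), pow_succ]
          linear_combination z ^ l * key
        ext v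
        simp only [_root_.add_apply, _root_.smul_apply]
        simp
        linear_combination (-((starRingEnd ℂ) z ^ m * v)) * key2

lemma division {ψ : ℂ → ℂ} (hψ : ContDiffAt ℝ (⊤ : ℕ∞) ψ 0)
    (hc : ∀ k, dzb^[k] ψ 0 = 0) :
    ∃ h : ℂ → ℂ, ContDiffAt ℝ (⊤ : ℕ∞) h 0 ∧ ∀ᶠ z in 𝓝 0, ψ z = z * h z := by
  have chain : ∀ m : ℕ, ∃ F g : ℂ → ℂ, ContDiffAt ℝ (⊤ : ℕ∞) F 0 ∧ ContDiffAt ℝ (⊤ : ℕ∞) g 0 ∧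
      ∀ᶠ z in 𝓝 0, ψ z = z * F z + (starRingEnd ℂ) z ^ m * g z := by
    intro m
    induction m with
    | zero => exact ⟨fun _ => 0, ψ, contDiffAt_const, hψ, by simp⟩
    | succ m ih =>
      obtain ⟨F, g, hF, hg, h⟩ := ih
      have hg0 : g 0 = 0 := by
        have h1 := key_formula (β := fun z => z) contDiffAt_id rfl m hF hg
        have h2 : (Dv (fun z => z)) = dzb := funext Dv_id
        rw [h2, ← (Wd_iter_congr 1 I m h).eq_of_nhds, hc m] at h1
        have h3 : dz (fun z => z) 0 = 1 := by
          have h : fderiv ℝ (fun z : ℂ => z) 0 = ContinuousLinearMap.id ℝ ℂ := fderiv_fun_id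
          simp [Wd, h]
        rw [h3, one_pow, mul_one] at h1
        exact (mul_eq_zero.1 h1.symm).resolve_left (by exact_mod_cast m.factorial_ne_zero)
      obtain ⟨g1, g2, hg1, hg2, hh⟩ := hadamard hg hg0
      refine ⟨fun z => F z + (starRingEnd ℂ) z ^ m * g1 z, g2,
        hF.add ((conj_contDiff.contDiffAt.pow m).mul hg1), hg2, ?_⟩
      filter_upwards [h, hh] with z h1 h2
      rw [h1, h2]
      ring
  obtain ⟨F1, g1, hF1, hg1, h1⟩ := chain 2
  have hψ0 : ψ 0 = 0 := by simpa using hc 0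
  refine ⟨fun z => if z = 0 then F1 0 else ψ z / z, ?_, ?_⟩
  · rw [contDiffAt_infty]
    intro n
    have form : ∀ m, 2 ≤ m → ∀ F g : ℂ → ℂ, ContDiffAt ℝ (⊤ : ℕ∞) F 0 →
        ContDiffAt ℝ (⊤ : ℕ∞) g 0 →
        (∀ᶠ z in 𝓝 0, ψ z = z * F z + (starRingEnd ℂ) z ^ m * g z) →
        ∀ᶠ z in 𝓝[≠] 0, ψ z / z = F z + (starRingEnd ℂ) z ^ m / z ^ 1 * g z := by
      intro m hm F g hF hg h
      filter_upwards [h.filter_mono nhdsWithin_le_nhds, self_mem_nhdsWithin] with z hz hz0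
      have hz0 : z ≠ 0 := hz0
      rw [hz]
      field_simp
    have lim : ∀ m, 2 ≤ m → ∀ F g : ℂ → ℂ, ContDiffAt ℝ (⊤ : ℕ∞) F 0 →
        ContDiffAt ℝ (⊤ : ℕ∞) g 0 →
        (∀ᶠ z in 𝓝 0, ψ z = z * F z + (starRingEnd ℂ) z ^ m * g z) →
        Tendsto (fun z => ψ z / z) (𝓝[≠] 0) (𝓝 (F 0)) := by
      intro m hm F g hF hg h
      have hcont : ContinuousAt (fun z => F z + (starRingEnd ℂ) z ^ m / z ^ 1 * g z) 0 :=
        hF.continuousAt.add (((conj_pow_div_contDiff 0 m 1 (by omega)).continuous.continuousAt).mul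
          hg.continuousAt)
      have := (hcont.tendsto.mono_left nhdsWithin_le_nhds).congr'
        ((form m hm F g hF hg h).mono fun z hz => hz.symm)
      simpa [zero_pow (show m ≠ 0 by omega)] using this
    obtain ⟨F, g, hF, hg, h⟩ := chain (n + 2)
    have hFF : F1 0 = F 0 := tendsto_nhds_unique (lim 2 le_rfl F1 g1 hF1 hg1 h1)
      (lim (n+2) (by omega) F g hF hg h)
    have hsm : ContDiffAt ℝ n
        (fun z => F z + (starRingEnd ℂ) z ^ (n + 2) / z ^ 1 * g z) 0 :=
      (hF.of_le (by exact_mod_cast le_top)).add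
        ((conj_pow_div_contDiff n (n+2) 1 (by omega)).contDiffAt.mul
          (hg.of_le (by exact_mod_cast le_top)))
    refine hsm.congr_of_eventuallyEq ?_
    filter_upwards [eventually_nhdsWithin_iff.1 (form (n+2) (by omega) F g hF hg h)] with z hz
    split_ifs with h0
    · subst h0
      simp [hFF]
    · exact hz h0
  · refine Eventually.of_forall fun z => ?_
    dsimp only
    split_ifs with h0
    · simp [h0, hψ0]
    · field_simp

/-- The antiholomorphic derivative in the first variable on `ℂ × ℂ`. -/
noncomputable abbrev Wu : (ℂ × ℂ → ℂ) → ℂ × ℂ → ℂ := Wd ((1, 0) : ℂ × ℂ) (I, 0)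

lemma leib (k : ℕ) : ∀ {A B : ℂ × ℂ → ℂ} (_ : ContDiffAt ℝ (⊤ : ℕ∞) A 0)
    (_ : ContDiffAt ℝ (⊤ : ℕ∞) B 0)
    (_ : ∀ j < k, ∀ᶠ p : ℂ × ℂ in 𝓝 0, p.1 = 0 → Wu^[j] A p = 0),
    ∀ᶠ p : ℂ × ℂ in 𝓝 0, p.1 = 0 → Wu^[k] (fun q => A q * B q) p = Wu^[k] A p * B p := by
  induction k with
  | zero => intro A B _ _ _; simp
  | succ k ih =>
    intro A B hA hB h
    have hWA := Wd_contDiffAt ((1, 0) : ℂ × ℂ) (I, 0) hA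
    have hWB := Wd_contDiffAt ((1, 0) : ℂ × ℂ) (I, 0) hB
    have h1 : Wu (fun q => A q * B q) =ᶠ[𝓝 0] fun q => Wu A q * B q + A q * Wu B q := by
      filter_upwards [ev_differentiable hA, ev_differentiable hB] with q h1 h2
      exact Wd_mul _ _ h1 h2
    have h2 := (Wd_iter_congr ((1, 0) : ℂ × ℂ) (I, 0) k h1).trans
      (Wd_iter_add ((1, 0) : ℂ × ℂ) (I, 0) k (hWA.mul hB) (hA.mul hWB))
    have h3 := ih hWA hB (fun j hj => by
      simpa only [← Function.iterate_succ_apply] using h (j + 1) (by omega))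
    have h4 := ih hA hWB (fun j hj => h j (by omega))
    filter_upwards [h2, h3, h4, h k (by omega)] with p e2 e3 e4 e5 hp
    rw [Function.iterate_succ_apply, e2, e3 hp, e4 hp, e5 hp, Function.iterate_succ_apply]
    ring

lemma ev_mul {P : ℂ → Prop} (h : ∀ᶠ z in 𝓝 0, P z) :
    ∀ᶠ p : ℂ × ℂ in 𝓝 0, P (p.1 * p.2) := by
  have hc : Continuous (fun p : ℂ × ℂ => p.1 * p.2) := by fun_prop
  have := hc.tendsto 0
  simp only [Prod.fst_zero, Prod.snd_zero, mul_zero] at this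
  exact this.eventually h

lemma Wu_chain {φ : ℂ → ℂ} (hφ : ContDiffAt ℝ (⊤ : ℕ∞) φ 0) :
    Wu (fun p => φ (p.1 * p.2)) =ᶠ[𝓝 0]
      fun p => (starRingEnd ℂ) p.2 * dzb φ (p.1 * p.2) := by
  filter_upwards [ev_mul (ev_differentiable hφ)] with p hp
  have h1 : HasFDerivAt (fun p : ℂ × ℂ => p.1 * p.2) _ p :=
    (hasFDerivAt_fst (𝕜 := ℝ) (p := p)).mul (hasFDerivAt_snd (𝕜 := ℝ) (p := p))
  have h2 : HasFDerivAt (fun p : ℂ × ℂ => φ (p.1 * p.2)) _ p := hp.hasFDerivAt.comp p h1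
  have e : ∀ w : ℂ, fderiv ℝ (fun p : ℂ × ℂ => φ (p.1 * p.2)) p (w, 0)
      = fderiv ℝ φ (p.1 * p.2) (p.2 * w) := by
    intro w
    rw [h2.fderiv]
    simp
  change (fderiv ℝ (fun p : ℂ × ℂ => φ (p.1 * p.2)) p (1, 0)
    + I * fderiv ℝ (fun p : ℂ × ℂ => φ (p.1 * p.2)) p (I, 0)) / 2 = _
  rw [e, e, fderiv_expand, fderiv_expand φ _ (p.2 * I)]
  simp only [mul_one, map_mul, conj_I]
  linear_combination (dz φ (p.1 * p.2) * p.2 / 2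
    - dzb φ (p.1 * p.2) * (starRingEnd ℂ) p.2 / 2) * I_mul_I

lemma Wu_snd {g : ℂ → ℂ} {p : ℂ × ℂ} (hg : DifferentiableAt ℝ g p.2) :
    Wu (fun p => g p.2) p = 0 := by
  have h2 : HasFDerivAt (fun p : ℂ × ℂ => g p.2) _ p :=
    hg.hasFDerivAt.comp p (hasFDerivAt_snd (𝕜 := ℝ) (p := p))
  simp [Wd, h2.fderiv]

lemma comp_mul_smooth {φ : ℂ → ℂ} (hφ : ContDiffAt ℝ (⊤ : ℕ∞) φ 0) :
    ContDiffAt ℝ (⊤ : ℕ∞) (fun p : ℂ × ℂ => φ (p.1 * p.2)) 0 := by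
  have h1 : ContDiffAt ℝ (⊤ : ℕ∞) (fun p : ℂ × ℂ => p.1 * p.2) 0 :=
    contDiffAt_fst.mul contDiffAt_snd
  exact ContDiffAt.comp (f := fun p : ℂ × ℂ => p.1 * p.2) 0 (by simpa using hφ) h1

lemma Wu_iter_chain {ψ : ℂ → ℂ} (hψ : ContDiffAt ℝ (⊤ : ℕ∞) ψ 0) (k : ℕ) :
    Wu^[k] (fun p => ψ (p.1 * p.2)) =ᶠ[𝓝 0]
      fun p => (starRingEnd ℂ) p.2 ^ k * dzb^[k] ψ (p.1 * p.2) := by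
  induction k with
  | zero => simp
  | succ k ih =>
    have hk := Wd_iter_contDiffAt 1 I k hψ
    rw [Function.iterate_succ_apply']
    refine (Wd_congr _ _ ih).trans ?_
    filter_upwards [Wu_chain hk, ev_differentiable (comp_mul_smooth hk)] with p h1 h2
    have h3 : DifferentiableAt ℝ (fun w : ℂ => (starRingEnd ℂ) w ^ k) p.2 :=
      (conj_hasFDerivAt _).differentiableAt.pow _
    have h4 : DifferentiableAt ℝ (fun p : ℂ × ℂ => (starRingEnd ℂ) p.2 ^ k) p :=
      DifferentiableAt.comp (g := fun w : ℂ => (starRingEnd ℂ) w ^ k)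
        (f := fun p : ℂ × ℂ => p.2) p h3 differentiableAt_snd
    have h1' : Wd ((1, 0) : ℂ × ℂ) (I, 0)
        (fun p : ℂ × ℂ => (Wd 1 I)^[k] ψ (p.1 * p.2)) p = _ := h1
    have h5 : Wd ((1, 0) : ℂ × ℂ) (I, 0) (fun p : ℂ × ℂ => (starRingEnd ℂ) p.2 ^ k) p = 0 :=
      Wu_snd (g := fun w : ℂ => (starRingEnd ℂ) w ^ k) h3
    refine (Wd_mul _ _ h4 h2).trans ?_
    rw [h1', h5, Function.iterate_succ_apply']
    ring

lemma axis_smooth {B : ℂ × ℂ → ℂ} (hB : ContDiffAt ℝ (⊤ : ℕ∞) B 0) :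
    ContDiffAt ℝ (⊤ : ℕ∞) (fun v : ℂ => B (0, v)) 0 := by
  refine ContDiffAt.comp (f := fun v : ℂ => ((0:ℂ), v)) 0 (show ContDiffAt ℝ _ B (0, 0) from hB) ?_
  exact contDiffAt_const.prodMk contDiffAt_id

lemma ev_axis {P : ℂ × ℂ → Prop} (h : ∀ᶠ p in 𝓝 0, P p) : ∀ᶠ v : ℂ in 𝓝 0, P (0, v) := by
  have hc : Continuous (fun v : ℂ => ((0:ℂ), v)) := by fun_prop
  exact (hc.tendsto 0).eventually h

lemma core {ψ : ℂ → ℂ} {A B : ℂ × ℂ → ℂ} (hψ : ContDiffAt ℝ (⊤ : ℕ∞) ψ 0)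
    (hA : ContDiffAt ℝ (⊤ : ℕ∞) A 0) (hB : ContDiffAt ℝ (⊤ : ℕ∞) B 0) (hB0 : B 0 = 0)
    (hAB : ∀ᶠ p : ℂ × ℂ in 𝓝 0, A p * B p = ψ (p.1 * p.2))
    (hne : ∀ᶠ v in 𝓝[≠] (0:ℂ), B (0, v) ≠ 0)
    (hγ : dz (fun v => B (0, v)) 0 ≠ 0) (k : ℕ) :
    dzb^[k] ψ 0 = 0 ∧ ∀ᶠ p : ℂ × ℂ in 𝓝 0, p.1 = 0 → Wu^[k] A p = 0 := by
  induction k using Nat.strong_induction_on with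
  | _ k ih =>
  have hβ := axis_smooth hB
  have h1 := leib k hA hB (fun j hj => (ih j hj).2)
  have h2 : Wu^[k] (fun q => A q * B q) =ᶠ[𝓝 0]
      fun p => (starRingEnd ℂ) p.2 ^ k * dzb^[k] ψ (p.1 * p.2) :=
    (Wd_iter_congr ((1, 0) : ℂ × ℂ) (I, 0) k hAB).trans (Wu_iter_chain hψ k)
  have hWk := Wd_iter_contDiffAt ((1, 0) : ℂ × ℂ) (I, 0) k hA
  have hX := axis_smooth hWk
  set c := dzb^[k] ψ 0 with hc
  have h3 : ∀ᶠ v in 𝓝 (0:ℂ), B (0, v) * Wu^[k] A (0, v) = (starRingEnd ℂ) v ^ k * c := by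
    filter_upwards [ev_axis h1, ev_axis h2] with v e1 e2
    have e1 := e1 rfl
    simp only [zero_mul] at e2
    rw [← hc] at e2
    rw [← e2, e1]
    ring
  have hc0 : c = 0 := by
    have f1 := key_formula hβ hB0 k hX (contDiffAt_const (c := -c))
    have f2 := key_formula hβ hB0 k (contDiffAt_const (c := (0:ℂ))) (contDiffAt_const (c := (0:ℂ)))
    have h4 : (fun v : ℂ => B (0, v) * Wu^[k] A (0, v) + (starRingEnd ℂ) v ^ k * -c) =ᶠ[𝓝 0]
        fun v => B (0, v) * 0 + (starRingEnd ℂ) v ^ k * 0 := by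
      filter_upwards [h3] with v e
      rw [e]
      ring
    rw [(Dv_iter_congr _ k h4).eq_of_nhds, f2] at f1
    have h5 : (k.factorial : ℂ) ≠ 0 := by exact_mod_cast k.factorial_ne_zero
    have h6 := pow_ne_zero k hγ
    simpa [h5, h6, hγ] using f1
  refine ⟨hc0, ?_⟩
  have h4 : ∀ᶠ v in 𝓝[≠] (0:ℂ), Wu^[k] A (0, v) = 0 := by
    filter_upwards [hne, h3.filter_mono nhdsWithin_le_nhds] with v e1 e2
    rw [hc0, mul_zero] at e2
    exact (mul_eq_zero.1 e2).resolve_left e1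
  have h5 : Wu^[k] A (0, 0) = 0 := by
    have t1 : Tendsto (fun v : ℂ => Wu^[k] A (0, v)) (𝓝[≠] 0) (𝓝 (Wu^[k] A (0, 0))) :=
      hX.continuousAt.tendsto.mono_left nhdsWithin_le_nhds
    have t2 : Tendsto (fun v : ℂ => Wu^[k] A (0, v)) (𝓝[≠] 0) (𝓝 0) :=
      tendsto_const_nhds.congr' (h4.mono fun v hv => hv.symm)
    exact tendsto_nhds_unique t1 t2
  have h6 : ∀ᶠ v in 𝓝 (0:ℂ), Wu^[k] A (0, v) = 0 := by
    filter_upwards [eventually_nhdsWithin_iff.1 h4] with v hv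
    by_cases h0 : v = 0
    · rw [h0, h5]
    · exact hv h0
  have h7 : ∀ᶠ p : ℂ × ℂ in 𝓝 0, Wu^[k] A (0, p.2) = 0 :=
    (continuous_snd.tendsto (0 : ℂ × ℂ)).eventually h6
  filter_upwards [h7] with p hp hp1
  rw [← hp, ← hp1]

lemma conj_smooth {E : Type} [NormedAddCommGroup E] [NormedSpace ℝ E] {f : E → ℂ} {p : E}
    (hf : ContDiffAt ℝ (⊤ : ℕ∞) f p) :
    ContDiffAt ℝ (⊤ : ℕ∞) (fun q => (starRingEnd ℂ) (f q)) p :=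
  ContDiffAt.comp (g := fun w : ℂ => (starRingEnd ℂ) w) p conj_contDiff.contDiffAt hf

lemma forward_aux {ψ : ℂ → ℂ} {A B : ℂ × ℂ → ℂ} (hψ : ContDiffAt ℝ (⊤ : ℕ∞) ψ 0)
    (hA : ContDiffAt ℝ (⊤ : ℕ∞) A 0) (hB : ContDiffAt ℝ (⊤ : ℕ∞) B 0) (hB0 : B 0 = 0)
    (hAB : ∀ᶠ p : ℂ × ℂ in 𝓝 0, A p * B p = ψ (p.1 * p.2))
    (hinj : ∀ v, fderiv ℝ (fun v : ℂ => B (0, v)) 0 v = 0 → v = 0) :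
    ∃ h : ℂ → ℂ, ContDiffAt ℝ (⊤ : ℕ∞) h 0 ∧ ((∀ᶠ z in 𝓝 0, ψ z = z * h z) ∨
         (∀ᶠ z in 𝓝 0, ψ z = (starRingEnd ℂ) z * h z)) := by
  have hβ := axis_smooth hB
  have hd : DifferentiableAt ℝ (fun v : ℂ => B (0, v)) 0 := hβ.differentiableAt (by simp)
  have hne : ∀ᶠ v in 𝓝[≠] (0:ℂ), B (0, v) ≠ 0 := by
    refine hd.hasFDerivAt.eventually_ne ?_
    obtain ⟨K, _, hK⟩ := LinearMap.exists_antilipschitzWith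
      (fderiv ℝ (fun v : ℂ => B (0, v)) 0 : ℂ →ₗ[ℝ] ℂ) (LinearMap.ker_eq_bot'.2 hinj)
    exact ⟨K, hK⟩
  by_cases hγ : dz (fun v => B (0, v)) 0 = 0
  · have hδ : dzb (fun v => B (0, v)) 0 ≠ 0 := by
      intro hδ
      have := hinj 1 (by rw [fderiv_expand, hγ, hδ]; simp)
      exact one_ne_zero this
    have hγ' : dz (fun v => (starRingEnd ℂ) (B (0, v))) 0 ≠ 0 := by
      have h1 : HasFDerivAt (fun v => (starRingEnd ℂ) (B (0, v))) _ 0 :=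
        (conj_hasFDerivAt _).comp 0 hd.hasFDerivAt
      have h2 : dz (fun v => (starRingEnd ℂ) (B (0, v))) 0
          = (starRingEnd ℂ) (dzb (fun v => B (0, v)) 0) := by
        simp [Wd, h1.fderiv, map_ofNat]
      rw [h2]
      simpa using hδ
    obtain ⟨h, hh, he⟩ := division (conj_smooth hψ) fun k =>
      (core (conj_smooth hψ) (conj_smooth hA) (conj_smooth hB) (by simp [hB0])
        (hAB.mono fun p hp => by rw [← map_mul, hp]) (hne.mono fun v hv => by simpa using hv)
        hγ' k).1
    refine ⟨_, conj_smooth hh, Or.inr ?_⟩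
    filter_upwards [he] with z hz
    rw [← map_mul, ← hz, conj_conj]
  · obtain ⟨h, hh, he⟩ := division hψ fun k => (core hψ hA hB hB0 hAB hne hγ k).1
    exact ⟨h, hh, Or.inl he⟩

lemma unit_of_factor {ψ e h : ℂ → ℂ} (hD : IsUnit (fderiv ℝ ψ 0)) (he : DifferentiableAt ℝ e 0)
    (he0 : e 0 = 0) (hh : ContDiffAt ℝ (⊤ : ℕ∞) h 0) (hev : ∀ᶠ z in 𝓝 0, ψ z = e z * h z) :
    h 0 ≠ 0 := by
  intro h0
  have h1 : fderiv ℝ ψ 0 = 0 := by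
    rw [EventuallyEq.fderiv_eq hev, fderiv_fun_mul he (hh.differentiableAt (by simp)), he0, h0]
    simp
  rw [h1] at hD
  exact not_isUnit_zero hD

lemma forward {ψ : ℂ → ℂ} (hψ : ContDiffAt ℝ (⊤ : ℕ∞) ψ 0) (hψ0 : ψ 0 = 0) (hL : Liftable ψ) :
    ∃ h : ℂ → ℂ, ContDiffAt ℝ (⊤ : ℕ∞) h 0 ∧ ((∀ᶠ z in 𝓝 0, ψ z = z * h z) ∨
         (∀ᶠ z in 𝓝 0, ψ z = (starRingEnd ℂ) z * h z)) := by
  obtain ⟨Ψ, hΨ, hΨ0, hU, hm⟩ := hL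
  have hbij := ContinuousLinearMap.isUnit_iff_bijective.1 hU
  set L := fderiv ℝ Ψ 0 with hLdef
  have hΨd : HasFDerivAt Ψ L 0 := (hΨ.differentiableAt (by simp)).hasFDerivAt
  have hA : ContDiffAt ℝ (⊤ : ℕ∞) (fun p => (Ψ p).1) 0 := hΨ.fst
  have hB : ContDiffAt ℝ (⊤ : ℕ∞) (fun p => (Ψ p).2) 0 := hΨ.snd
  have hax : HasFDerivAt (fun v : ℂ => ((0:ℂ), v)) (ContinuousLinearMap.inr ℝ ℂ ℂ) 0 :=
    (ContinuousLinearMap.inr ℝ ℂ ℂ).hasFDerivAt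
  have hΨv : HasFDerivAt (fun v : ℂ => Ψ (0, v)) (L.comp (ContinuousLinearMap.inr ℝ ℂ ℂ)) 0 :=
    HasFDerivAt.comp (g := Ψ) (f := fun v : ℂ => ((0:ℂ), v)) 0 hΨd hax
  have dA : ∀ v, fderiv ℝ (fun v : ℂ => (Ψ (0, v)).1) 0 v = (L (0, v)).1 := by
    intro v; rw [hΨv.fst.fderiv]; simp
  have dB : ∀ v, fderiv ℝ (fun v : ℂ => (Ψ (0, v)).2) 0 v = (L (0, v)).2 := by
    intro v; rw [hΨv.snd.fderiv]; simp
  have hprod : ∀ v : ℂ, (L (0, v)).1 * (L (0, v)).2 = 0 := by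
    intro v
    have hl : HasDerivAt (fun t : ℝ => t • v) v 0 := by
      simpa using (hasDerivAt_id (0:ℝ)).smul_const v
    have hΨv' : HasFDerivAt (fun v : ℂ => Ψ (0, v)) (L.comp (ContinuousLinearMap.inr ℝ ℂ ℂ))
        ((0:ℝ) • v) := by simpa using hΨv
    have d1 : HasDerivAt (fun t : ℝ => Ψ (0, t • v)) (L (0, v)) 0 := by
      have := hΨv'.comp_hasDerivAt (0:ℝ) hl
      exact this
    have s := hasDerivAt_iff_tendsto_slope_zero.1 d1
    have h00 : Ψ (0, (0:ℝ) • v) = 0 := by rw [zero_smul]; exact hΨ0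
    simp only [zero_add, h00, sub_zero] at s
    have s2 := ((continuous_fst.tendsto _).comp s).mul ((continuous_snd.tendsto _).comp s)
    refine tendsto_nhds_unique s2 (tendsto_const_nhds.congr' ?_)
    have hc : Tendsto (fun t : ℝ => ((0:ℂ), t • v)) (𝓝[≠] 0) (𝓝 0) := by
      have h1 : Continuous (fun t : ℝ => ((0:ℂ), t • v)) := by fun_prop
      have := h1.tendsto 0
      rw [zero_smul] at this
      exact this.mono_left nhdsWithin_le_nhds
    filter_upwards [hc.eventually hm] with t ht
    simp only [zero_mul, hψ0] at ht
    simp only [Function.comp, Prod.smul_fst, Prod.smul_snd, smul_mul_smul_comm, ht, smul_zero]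
  have hinj : ∀ v : ℂ, (L (0, v)).1 = 0 → (L (0, v)).2 = 0 → v = 0 := by
    intro v h1 h2
    have : L (0, v) = L 0 := by rw [map_zero]; exact Prod.ext h1 h2
    exact (Prod.ext_iff.1 (hbij.1 this)).2
  by_cases hz : ∀ v, (L (0, v)).1 = 0
  · exact forward_aux hψ hA hB (by simp [hΨ0]) hm
      (fun v hv => hinj v (hz v) (by rw [← dB, hv]))
  · push Not at hz
    obtain ⟨v1, h1⟩ := hz
    have hz2 : ∀ v, (L (0, v)).2 = 0 := by
      intro v2
      by_contra h2
      have e1 := (mul_eq_zero.1 (hprod v1)).resolve_left h1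
      have e2 := (mul_eq_zero.1 (hprod v2)).resolve_right h2
      have e3 := hprod (v1 + v2)
      have e4 : L (0, v1 + v2) = L (0, v1) + L (0, v2) := by rw [← map_add]; simp
      rw [e4, Prod.fst_add, Prod.snd_add, e1, e2] at e3
      simp [h1, h2] at e3
    exact forward_aux hψ hB hA (by simp [hΨ0]) (hm.mono fun p hp => by rw [mul_comm, hp])
      (fun v hv => hinj v (by rw [← dA, hv]) (hz2 v))

lemma backward {ψ h : ℂ → ℂ} (e : ℂ ≃L[ℝ] ℂ) (hmul : ∀ u v, e (u * v) = e u * e v)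
    (hh : ContDiffAt ℝ (⊤ : ℕ∞) h 0) (h0 : h 0 ≠ 0) (hev : ∀ᶠ z in 𝓝 0, ψ z = e z * h z) :
    Liftable ψ := by
  have hH := comp_mul_smooth hh
  have he1 : ContDiffAt ℝ (⊤ : ℕ∞) (fun p : ℂ × ℂ => e p.1) 0 :=
    (e.contDiff.comp contDiff_fst).contDiffAt
  have he2 : ContDiffAt ℝ (⊤ : ℕ∞) (fun p : ℂ × ℂ => e p.2) 0 :=
    (e.contDiff.comp contDiff_snd).contDiffAt
  refine ⟨fun p => (e p.1, e p.2 * h (p.1 * p.2)), he1.prodMk (he2.mul hH), by simp, ?_, ?_⟩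
  · have d1 : HasFDerivAt (fun p : ℂ × ℂ => e p.1) _ 0 :=
      e.hasFDerivAt.comp (0 : ℂ × ℂ) (hasFDerivAt_fst (𝕜 := ℝ))
    have d2 : HasFDerivAt (fun p : ℂ × ℂ => e p.2) _ 0 :=
      e.hasFDerivAt.comp (0 : ℂ × ℂ) (hasFDerivAt_snd (𝕜 := ℝ))
    have d3 := d1.prodMk (d2.fun_mul (hH.differentiableAt (by simp)).hasFDerivAt)
    have key : ∀ p : ℂ × ℂ, fderiv ℝ (fun p : ℂ × ℂ => (e p.1, e p.2 * h (p.1 * p.2))) 0 p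
        = (e p.1, h 0 * e p.2) := by
      intro p
      rw [d3.fderiv]
      simp
    rw [ContinuousLinearMap.isUnit_iff_bijective]
    constructor
    · intro p q hpq
      rw [key, key] at hpq
      obtain ⟨a, b⟩ := Prod.ext_iff.1 hpq
      exact Prod.ext (e.injective a) (e.injective (mul_left_cancel₀ h0 b))
    · intro q
      refine ⟨(e.symm q.1, e.symm (q.2 / h 0)), ?_⟩
      rw [key]
      ext <;> simp [mul_div_cancel₀, h0]
  · filter_upwards [ev_mul hev] with p hp
    simp only [hp, hmul]
    ring

/-- A local diffeomorphism germ `ψ` of `(ℂ, 0)` is liftable iff it can be written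
either as `ψ z = z · h z` or as `ψ z = conj z · h z` near `0`, with `h` smooth near
`0` and `h 0 ≠ 0`. -/
theorem statement0 (ψ : ℂ → ℂ) (hψ : ContDiffAt ℝ (⊤ : ℕ∞) ψ 0) (hψ0 : ψ 0 = 0)
    (hD : IsUnit (fderiv ℝ ψ 0)) :
    Liftable ψ ↔
      ∃ h : ℂ → ℂ, ContDiffAt ℝ (⊤ : ℕ∞) h 0 ∧ h 0 ≠ 0 ∧
        ((∀ᶠ z in 𝓝 0, ψ z = z * h z) ∨
         (∀ᶠ z in 𝓝 0, ψ z = (starRingEnd ℂ) z * h z)) := by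
  constructor
  · intro hL
    obtain ⟨h, hh, he⟩ := forward hψ hψ0 hL
    refine ⟨h, hh, ?_, he⟩
    rcases he with he | he
    · exact unit_of_factor hD differentiableAt_id rfl hh he
    · exact unit_of_factor hD (conj_hasFDerivAt 0).differentiableAt (map_zero _) hh he
  · rintro ⟨h, hh, h0, he | he⟩
    · exact backward (ContinuousLinearEquiv.refl ℝ ℂ) (fun _ _ => rfl) hh h0 he
    · exact backward conjCLE (fun u v => by simp) hh h0 (by simpa using he)
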